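/- Let p be a prime, n ≥ 1 and e ≥ 1, with (n,p) not equal to (1,2), (1,3), or (2,2). Then the group Sp(2n, ℤ/p^eℤ) is perfect: it equals its own commutator subgroup. -/

import Mathlib

namespace SymplecticGroup

open Matrix
open scoped commutatorElement

variable {l R : Type*} [DecidableEq l] [Fintype l] [CommRing R] {A B C D : Matrix l l R}

/-- Given square matrices `A` and `C` over a field, if the only vector annihilated by both of
them is 0, and `Aᵀ * C = Cᵀ * A`, then one can construct a symmetric matrix `X` such that
`A + X * C` is invertible. The proof is that of a private lemma of Mathlib. -/
lemma exists_symmetric_X_invertible_add_mul_of_ker_inter_eq_bot {R : Type*} [Field R]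
    {A C : Matrix l l R} (hker : ∀ (x : l → R), (A • x = 0) → (C • x = 0) → x = 0)
    (hsymm : Aᵀ * C = Cᵀ * A) :
    ∃ (X : Matrix l l R), X.IsSymm ∧ IsUnit (A + X * C) := by
  -- `C` is transformed into `P = fromBlocks 1 0 0 0` by invertible matrices `V` and `U`.
  rcases exists_rank_normal_form C with ⟨V, U, s, hV, hU, heq⟩
  set P := V * C * U with P_def; set Q := Vᵀ⁻¹ * A * U with Q_def
  set f := fun (x : Matrix l l R) ↦ x.submatrix s.symm s.symm
  have hf (x) : f x = x.submatrix s.symm s.symm := rfl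
  have f_unit {x} : IsUnit x → IsUnit (f x) := (isUnit_submatrix_equiv ..).2
  have f_mul (x y) : f (x * y) = f x * f y := submatrix_mul _ _ _ _ _ s.symm.bijective
  have _ : Invertible V := hV.invertible
  have _ : Invertible U := hU.invertible
  have _ : Invertible (f Vᵀ) := (f_unit (V.isUnit_transpose.2 hV)).invertible
  -- The hypothesis that the only vector annihilated by both matrices is 0, holds for `P` and `Q`.
  have con1 (x : Fin C.rank ⊕ Fin (Fintype.card l - C.rank) → R)
      (heq1 : (f Q) • x = 0) (heq2 : (f P) • x = 0) : x = 0 := by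
    refine (f_unit hU).smul_left_cancel.1 ?_
    rw [f_mul, f_mul, mul_assoc, mul_smul, IsUnit.smul_eq_zero, mul_smul, hf,
      smul_eq_mulVec, submatrix_mulVec_equiv, Equiv.symm_symm] at heq1 heq2
    · rw [Equiv.comp_symm_eq, Pi.zero_comp] at heq1 heq2
      exact s.surjective.injective_comp_right <| by simpa using hker _ heq1 heq2
    · exact f_unit hV
    · exact f_unit <| isUnit_nonsing_inv_iff.2 <| V.isUnit_transpose.2 hV
  -- The symmetry relation also holds for `P` and `Q`.
  have con2 : Qᵀ * P = Pᵀ * Q := by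
    simp only [P_def, mul_assoc, transpose_mul, transpose_nonsing_inv, transpose_transpose, Q_def,
      inv_mul_cancel_left_of_invertible, mul_inv_cancel_left_of_invertible]
    rw [← mul_assoc Aᵀ, hsymm, mul_assoc]
  replace con2 : (f Q).toBlocks₁₁ᵀ = (f Q).toBlocks₁₁ ∧ (f Q).toBlocks₁₂ = 0 := by
    apply_fun reindex s s at con2
    rw [reindex_apply, reindex_apply, ← hf, ← hf, f_mul, f_mul Pᵀ, heq, hf,
      ← transpose_submatrix, ← hf Q, ← (f Q).fromBlocks_toBlocks, hf (_)ᵀ, hf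
      ((fromBlocks 1 0 0 0).submatrix _ _)] at con2
    simp [fromBlocks_transpose, fromBlocks_multiply] at con2; tauto
  -- The lower-right block of `Q` is invertible.
  have con3 : IsUnit (f Q).toBlocks₂₂ := by
    refine mulVec_injective_iff_isUnit.1 ?_
    rw [← coe_mulVecLin, ← LinearMap.ker_eq_bot]
    refine ker_mulVecLin_eq_bot_iff.2 fun x hx ↦ Sum.elim_injective' <|
      (con1 _ ?_ ?_).trans Sum.elim_zero_zero.symm
    · rw [← (f Q).fromBlocks_toBlocks]; simp [hx, con2.2, fromBlocks_mulVec]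
    · simp [hf, heq, fromBlocks_mulVec]
  set Y : Matrix (Fin C.rank ⊕ Fin (Fintype.card l - C.rank)) (Fin C.rank ⊕
    Fin (Fintype.card l - C.rank)) R := fromBlocks (1 - (f Q).toBlocks₁₁) 0 0 0 with Y_def
  have hY_symm : Y.IsSymm := by
    rw [Y_def, isSymm_fromBlocks_iff]
    exact ⟨IsSymm.sub isSymm_one con2.1, by simp⟩
  -- We now take `X = Vᵀ * Y * V` and this gives the desired matrix `X.submatrix s s`.
  set X := (f Vᵀ) * Y * (f V) with X_def
  refine ⟨X.submatrix s s, IsSymm.submatrix ?_ s, (isUnit_submatrix_equiv s.symm s.symm).1 ?_⟩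
  · simp_rw [X_def, Matrix.IsSymm, transpose_mul, hY_symm.eq, hf, transpose_submatrix,
      transpose_transpose, mul_assoc]
  · have heq' : f (A + X.submatrix s s * C) = (f Vᵀ) * (f Q + Y * (f P)) * f (U⁻¹) := by
      simp_rw [hf, submatrix_add, Pi.add_apply, Q_def, P_def, ← hf, f_mul, hf, mul_add, ← mul_assoc,
        ← inv_submatrix_equiv, add_mul, mul_assoc _ (U.submatrix _ _), mul_inv_of_invertible]
      simp [X_def]; rfl
    rw [← hf, heq', IsUnit.mul_iff, IsUnit.mul_iff]
    refine ⟨⟨isUnit_of_invertible _, ?_⟩, ?_⟩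
    · nth_rw 1 [Y_def, heq, ← (f Q).fromBlocks_toBlocks, con2.2]
      simpa [hf, fromBlocks_multiply, fromBlocks_add]
    · exact f_unit <| isUnit_nonsing_inv_iff.2 hU

/-- For any symplectic matrix `fromBlocks A B C D` over a local ring `R`, we can construct
a symmetric `X` s.t. `A + X * C` is invertible.

Introducing local ring hypothesis enables us to transport the construction of `X`
(from the previous lemma, which works only over fields) back to `R` while keeping
`A + X * C` invertible. -/
lemma exists_symmetric_X_isUnit_det_add_mul_of_symplectic [IsLocalRing R]
    (hA : fromBlocks A B C D ∈ symplecticGroup l R) :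
    ∃ (X : Matrix l l R), X.IsSymm ∧ IsUnit (A + X * C).det := by
  -- We utilize the previous result on field by mapping the symplectic matrix to residue field.
  set k := IsLocalRing.ResidueField R; set f := IsLocalRing.residue R
  set A' := f.mapMatrix A; set C' := f.mapMatrix C
  set F' := fromBlocks A' (f.mapMatrix B) C' (f.mapMatrix D) with F'_def
  have hF' : IsUnit F' := by
    refine F'.isUnit_iff_isUnit_det.2 ?_
    convert (symplectic_det hA).map f
    rw [RingHom.map_det, RingHom.mapMatrix_apply, Matrix.fromBlocks_map]; rfl
  have hker (x : l → k) (hx1 : A' *ᵥ x = 0) (hx2 : C' *ᵥ x = 0) : x = 0 := by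
    have hv0 : F' *ᵥ (Sum.elim x 0) = F' *ᵥ (Sum.elim 0 0) := by
      simp [fromBlocks_mulVec, hx1, hx2, F'_def]
    exact (Sum.elim_eq_iff.1 (mulVec_injective_iff_isUnit.2 hF' hv0)).1
  -- Solve the problem over the residue field, for the reductions of `A` and `C`.
  obtain ⟨Y, hY_symm, hY_det⟩ :=
    exists_symmetric_X_invertible_add_mul_of_ker_inter_eq_bot hker <| by
      change f.mapMatrix Aᵀ * f.mapMatrix C = f.mapMatrix Cᵀ * f.mapMatrix A
      rw [← map_mul, (fromBlocks_mem_iff.1 hA).1, map_mul]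
  -- Lift `Y` back to the ring `R` and we have the `X` we need.
  obtain ⟨X, hX_symm, hXY⟩ : ∃ X : Matrix l l R, X.IsSymm ∧ X.map f = Y := by
    choose s hs using @IsLocalRing.residue_surjective R _ _
    exact ⟨Y.map s, hY_symm.map s, Matrix.ext fun i j ↦ hs (Y i j)⟩
  refine ⟨X, hX_symm, (IsLocalRing.residue_ne_zero_iff_isUnit _).1 ?_⟩
  -- Ensure `A + X * C` is still invertible in `R`.
  rw [RingHom.map_det, map_add, map_mul, RingHom.mapMatrix_apply _ X, hXY]
  exact ((isUnit_iff_isUnit_det _).1 hY_det).ne_zero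

/-- The submonoid of matrices generated by the invertible symmetric matrices. -/
def symmProducts (l R : Type*) [DecidableEq l] [Fintype l] [CommRing R] :
    Submonoid (Matrix l l R) :=
  Submonoid.closure {S | S.IsSymm ∧ IsUnit S}

lemma diagonal_mem_symmProducts {d : l → R} (hd : ∀ i, IsUnit (d i)) :
    diagonal d ∈ symmProducts l R := by
  refine Submonoid.subset_closure ⟨isSymm_diagonal d, ?_⟩
  rw [isUnit_iff_isUnit_det, det_diagonal]
  exact (Finset.univ.prod_induction d IsUnit (fun _ _ => IsUnit.mul) isUnit_one fun i _ => hd i)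

lemma transvection_mem_symmProducts {i j : l} (hij : i ≠ j) (c : R) :
    transvection i j c ∈ symmProducts l R := by
  have hsingle : swap R i j * single i j c = single j j c := by
    ext a b
    by_cases hai : a = i
    · subst hai; simp [hij, hij.symm]
    · by_cases haj : a = j
      · subst haj; simp [single_apply]
      · rw [swap_mul_of_ne hai haj]
        simp [Ne.symm hai, Ne.symm haj]
  have hswap : IsUnit (swap R i j) := IsUnit.of_mul_eq_one _ (swap_mul_self i j)
  have hT : swap R i j * transvection i j c = swap R i j + single j j c := by
    rw [transvection, mul_add, mul_one, hsingle]
  have hdecomp : transvection i j c = swap R i j * (swap R i j * transvection i j c) := by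
    rw [← mul_assoc, swap_mul_self, one_mul]
  rw [hdecomp]
  refine mul_mem (Submonoid.subset_closure ⟨isSymm_swap i j, hswap⟩)
    (Submonoid.subset_closure ⟨?_, hswap.mul ?_⟩)
  · rw [hT]
    exact (isSymm_swap i j).add (by simp [Matrix.IsSymm, transpose_single])
  · rw [isUnit_iff_isUnit_det, det_transvection_of_ne i j hij]
    exact isUnit_one

lemma one_add_sum_single_mem_symmProducts (j : l) (w : l → R) (t : Finset l) (ht : j ∉ t) :
    1 + ∑ i ∈ t, single i j (w i) ∈ symmProducts l R := by
  induction t using Finset.induction_on with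
  | empty => simp [one_mem]
  | insert i t hi ih =>
    rw [Finset.mem_insert, not_or] at ht
    have hmul : 1 + ∑ k ∈ insert i t, single k j (w k) =
        (1 + ∑ k ∈ t, single k j (w k)) * transvection i j (w i) := by
      rw [Finset.sum_insert hi, transvection, mul_add, mul_one, add_mul, Finset.sum_mul,
        Finset.sum_eq_zero fun k _ => single_mul_single_of_ne (w k) k j i ht.1 (w i)]
      simp only [one_mul, add_zero]
      abel
    rw [hmul]
    exact mul_mem (ih ht.2) (transvection_mem_symmProducts (Ne.symm ht.1) _)

lemma updateCol_one_mem_symmProducts (j : l) (v : l → R) (hv : IsUnit (v j)) :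
    updateCol (1 : Matrix l l R) j v ∈ symmProducts l R := by
  have hmul : updateCol (1 : Matrix l l R) j v =
      diagonal (Function.update (fun _ => 1) j (v j)) *
        (1 + ∑ i ∈ Finset.univ.erase j, single i j (v i)) := by
    ext a b
    rw [diagonal_mul, Matrix.add_apply, Matrix.sum_apply]
    by_cases hb : b = j
    · subst hb
      by_cases ha : a = b
      · subst ha; simp [single_apply]
      · simp [single_apply, ha]
    · by_cases ha : a = b
      · subst ha; simp [hb, Ne.symm hb]
      · simp [hb, ha, Ne.symm hb]
  rw [hmul]
  refine mul_mem (diagonal_mem_symmProducts fun i => ?_)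
    (one_add_sum_single_mem_symmProducts j _ _ (by simp))
  by_cases hij : i = j
  · subst hij; simpa
  · simp [hij]

lemma mem_symmProducts_of_map_residue_eq_one [IsLocalRing R] (A : Matrix l l R)
    (hA : A.map (IsLocalRing.residue R) = 1) : A ∈ symmProducts l R := by
  suffices ∀ (s : Finset l) (A : Matrix l l R), A.map (IsLocalRing.residue R) = 1 →
      (∀ j ∉ s, ∀ i, A i j = (1 : Matrix l l R) i j) → A ∈ symmProducts l R from
    this Finset.univ A hA (by simp)
  intro s
  induction s using Finset.induction_on with
  | empty =>
    intro A _ h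
    rw [show A = 1 from Matrix.ext fun i j => h j (by simp) i]
    exact one_mem _
  | insert j s hj ih =>
    intro A hA h
    have hres (i k) : IsLocalRing.residue R (A i k) = (1 : Matrix l l _) i k := by
      rw [← hA, map_apply]
    have hu : IsUnit (A j j) := by
      rw [← IsLocalRing.residue_ne_zero_iff_isUnit, hres]
      simp
    obtain ⟨u, hu'⟩ := hu
    set E := updateCol (1 : Matrix l l R) j (fun i => A i j) with hE
    set A' : Matrix l l R :=
      of fun i k => if i = j then ↑u⁻¹ * A j k else A i k - A i j * (↑u⁻¹ * A j k) with hA'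
    have hmul : A = E * A' := by
      have hEA (i k) : (E * A') i k = (if i = j then 0 else A' i k) + A i j * A' j k := by
        have : E = diagonal (fun i => if i = j then 0 else 1) +
            vecMulVec (fun i => A i j) (Pi.single j 1) := by
          ext a b
          by_cases hb : b = j
          · subst hb; by_cases ha : a = b <;> simp [hE, vecMulVec_apply, ha]
          · by_cases ha : a = b
            · subst ha; simp [hE, vecMulVec_apply, hb]
            · simp [hE, vecMulVec_apply, hb, ha]
        rw [this, add_mul, vecMulVec_mul]
        simp [vecMulVec_apply]
      ext i k
      rw [hEA]
      by_cases hi : i = j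
      · subst hi; simp [hA', ← hu']
      · simp [hA', hi]
    rw [hmul]
    refine mul_mem (updateCol_one_mem_symmProducts j _ ⟨u, hu'⟩) (ih A' ?_ ?_)
    · have hures : IsLocalRing.residue R ↑u⁻¹ = 1 := by
        have : IsLocalRing.residue R (↑u⁻¹ * ↑u) = 1 := by simp
        rwa [map_mul, hu', hres, one_apply_eq, mul_one] at this
      ext i k
      by_cases hi : i = j
      · subst hi; simp [hA', hures, hres]
      · simp [hA', hi, hures, hres]
    · intro k hk i
      by_cases hkj : k = j
      · subst hkj
        by_cases hi : i = k
        · subst hi; simp [hA', ← hu']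
        · simp [hA', hi, ← hu']
      · have hjk : A j k = 0 := by
          rw [h k (by simp [hkj, hk]), one_apply_ne (Ne.symm hkj)]
        by_cases hi : i = j
        · subst hi; simp [hA', hjk, Ne.symm hkj]
        · simp [hA', hi, hjk, h k (by simp [hkj, hk])]

/-- Over a local ring every invertible matrix is a product of invertible symmetric matrices. -/
lemma mem_symmProducts_of_isUnit [IsLocalRing R] {A : Matrix l l R} (hA : IsUnit A) :
    A ∈ symmProducts l R := by
  set f := IsLocalRing.residue R
  have hlift : ∃ S ∈ symmProducts l R, S.map f = A.map f := by
    refine diagonal_transvection_induction_of_det_ne_zero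
      (fun M => ∃ S ∈ symmProducts l R, S.map f = M) (A.map f) ?_ ?_ ?_ ?_
    · have := ((isUnit_iff_isUnit_det _).1 hA).map f
      rw [RingHom.map_det] at this
      exact this.ne_zero
    · intro d hd
      choose s hs using @IsLocalRing.residue_surjective R _ _
      refine ⟨diagonal (s ∘ d), diagonal_mem_symmProducts fun i => ?_, ?_⟩
      · rw [← IsLocalRing.residue_ne_zero_iff_isUnit, Function.comp_apply, hs]
        rw [det_diagonal] at hd
        exact Finset.prod_ne_zero_iff.1 hd i (Finset.mem_univ i)
      · rw [diagonal_map (map_zero f)]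
        congr 1
        exact funext fun i => hs (d i)
    · intro t
      obtain ⟨c, hc⟩ := IsLocalRing.residue_surjective t.c
      refine ⟨transvection t.i t.j c, transvection_mem_symmProducts t.hij c, ?_⟩
      ext a b
      rw [TransvectionStruct.toMatrix]
      simp only [transvection, ← hc, map_apply, Matrix.add_apply, one_apply, single_apply]
      split_ifs <;> simp [f]
    · rintro M N - - ⟨S, hS, rfl⟩ ⟨T, hT, rfl⟩
      exact ⟨S * T, mul_mem hS hT, Matrix.map_mul⟩
  obtain ⟨S, hS, hSA⟩ := hlift
  have hSu : IsUnit S.det := by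
    rw [← IsLocalRing.residue_ne_zero_iff_isUnit, RingHom.map_det]
    have := ((isUnit_iff_isUnit_det _).1 hA).map f
    rw [RingHom.map_det] at this
    change det (S.map f) ≠ 0
    rw [hSA]
    exact this.ne_zero
  have hker : (S⁻¹ * A).map f = 1 := by
    rw [Matrix.map_mul, ← hSA, ← Matrix.map_mul, nonsing_inv_mul _ hSu]
    simp
  have := mul_mem hS (mem_symmProducts_of_map_residue_eq_one _ hker)
  rwa [mul_nonsing_inv_cancel_left _ _ hSu] at this

/-- The commutator subgroup of the symplectic group, as a submonoid of matrices. -/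
def commutatorMatrices (l R : Type*) [DecidableEq l] [Fintype l] [CommRing R] :
    Submonoid (Matrix (l ⊕ l) (l ⊕ l) R) :=
  (commutator (symplecticGroup l R)).toSubmonoid.map (symplecticGroup l R).subtype

lemma mem_commutatorMatrices_of_mul_eq {S T M : Matrix (l ⊕ l) (l ⊕ l) R}
    (hS : S ∈ symplecticGroup l R) (hT : T ∈ symplecticGroup l R)
    (hM : M ∈ symplecticGroup l R) (h : S * T = M * (T * S)) :
    M ∈ commutatorMatrices l R := by
  refine ⟨⟨M, hM⟩, ?_, rfl⟩
  have : (⟨M, hM⟩ : symplecticGroup l R) =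
      ⁅(⟨S, hS⟩ : symplecticGroup l R), (⟨T, hT⟩ : symplecticGroup l R)⁆ := by
    rw [commutatorElement_def, mul_assoc, ← _root_.mul_inv_rev, eq_mul_inv_iff_mul_eq]
    exact Subtype.ext h.symm
  rw [this]
  change _ ∈ commutator (symplecticGroup l R)
  exact Subgroup.commutator_mem_commutator (Subgroup.mem_top _) (Subgroup.mem_top _)

lemma mem_commutatorMatrices_of_conj {S M N : Matrix (l ⊕ l) (l ⊕ l) R}
    (hS : S ∈ symplecticGroup l R) (hN : N ∈ symplecticGroup l R)
    (hM : M ∈ commutatorMatrices l R) (h : S * M = N * S) :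
    N ∈ commutatorMatrices l R := by
  obtain ⟨m, hm, rfl⟩ := hM
  refine ⟨⟨N, hN⟩, ?_, rfl⟩
  have : (⟨N, hN⟩ : symplecticGroup l R) = ⟨S, hS⟩ * m * ⟨S, hS⟩⁻¹ := by
    rw [eq_mul_inv_iff_mul_eq]
    exact Subtype.ext h.symm
  rw [this]
  exact Subgroup.Normal.conj_mem inferInstance m hm _

lemma upper_mem {X : Matrix l l R} (hX : X.IsSymm) :
    fromBlocks 1 X 0 1 ∈ symplecticGroup l R := by
  simp [fromBlocks_mem_iff, hX.eq]

lemma lower_mem {X : Matrix l l R} (hX : X.IsSymm) :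
    fromBlocks 1 0 X 1 ∈ symplecticGroup l R := by
  simp [fromBlocks_mem_iff, hX.eq]

lemma blockDiagonal_mem {A B : Matrix l l R} (h : A * B = 1) :
    fromBlocks A 0 0 Bᵀ ∈ symplecticGroup l R := by
  simp [fromBlocks_mem_iff, ← transpose_mul, mul_eq_one_comm.1 h]

/-- The matrices `X` for which the unipotent matrix `fromBlocks 1 X 0 1` lies in the commutator
subgroup of the symplectic group. -/
def commutatorUpper (l R : Type*) [DecidableEq l] [Fintype l] [CommRing R] :
    AddSubmonoid (Matrix l l R) where
  carrier := {X | fromBlocks 1 X 0 1 ∈ commutatorMatrices l R}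
  zero_mem' := by
    simp only [Set.mem_ofPred_eq, fromBlocks_one]
    exact one_mem _
  add_mem' {X Y} hX hY := by
    rw [Set.mem_ofPred_eq] at hX hY ⊢
    have := mul_mem hX hY
    simpa [fromBlocks_multiply, add_comm] using this

lemma mem_commutatorUpper {X : Matrix l l R} :
    X ∈ commutatorUpper l R ↔ fromBlocks 1 X 0 1 ∈ commutatorMatrices l R := Iff.rfl

lemma mul_mul_transpose_sub_mem_commutatorUpper {T X : Matrix l l R} (hT : IsUnit T)
    (hX : X.IsSymm) : T * X * Tᵀ - X ∈ commutatorUpper l R := by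
  obtain ⟨S, hTS⟩ := hT.exists_right_inv
  have hSymm : (T * X * Tᵀ - X).IsSymm := by
    simp [Matrix.IsSymm, transpose_mul, hX.eq, mul_assoc]
  refine mem_commutatorMatrices_of_mul_eq (blockDiagonal_mem hTS) (upper_mem hX)
    (upper_mem hSymm) ?_
  have h : Tᵀ * Sᵀ = 1 := by rw [← transpose_mul, mul_eq_one_comm.1 hTS, transpose_one]
  simp [fromBlocks_multiply, sub_mul, mul_assoc, h]

lemma mem_of_isSymm {P : AddSubmonoid (Matrix l l R)} (hdiag : ∀ i a, single i i a ∈ P)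
    (hoff : ∀ i j, i ≠ j → ∀ a, single i j a + single j i a ∈ P) {X : Matrix l l R}
    (hX : X.IsSymm) : X ∈ P := by
  classical
  let _ : LinearOrder l := linearOrderOfSTO WellOrderingRel
  let Y : Matrix l l R := of fun i j => if i < j then X i j else 0
  have hsum : X = ∑ i, single i i (X i i) +
      ∑ i, ∑ j, (single i j (Y i j) + single j i (Y i j)) := by
    have h1 : ∑ i, ∑ j, (single i j (Y i j) + single j i (Y i j)) = Y + Yᵀ := by
      conv_rhs => rw [matrix_eq_sum_single Y]
      simp [transpose_sum, transpose_single, Finset.sum_add_distrib]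
    have h2 : ∑ i, single i i (X i i) = diagonal (fun i => X i i) := by
      ext a b
      simp [Matrix.sum_apply, single_apply, diagonal_apply, ite_and]
    rw [h1, h2]
    ext a b
    rcases lt_trichotomy a b with h | h | h
    · simp [Y, h, h.ne, h.not_gt]
    · subst h; simp [Y]
    · simp [Y, h, h.ne', h.not_gt, hX.apply]
  rw [hsum]
  refine add_mem (sum_mem fun i _ => hdiag i _) (sum_mem fun i _ => sum_mem fun j _ => ?_)
  by_cases hij : i = j
  · subst hij; simp [Y]
  · exact hoff i j hij _

lemma isUnit_transvection {i j : l} (hij : i ≠ j) (c : R) : IsUnit (transvection i j c) := by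
  rw [isUnit_iff_isUnit_det, det_transvection_of_ne i j hij]
  exact isUnit_one

lemma add_single_mem_commutatorUpper {i j : l} (hij : i ≠ j) (t a : R) :
    single i j (t * a) + single j i (t * a) + single i i (t ^ 2 * a) ∈ commutatorUpper l R := by
  convert mul_mul_transpose_sub_mem_commutatorUpper (isUnit_transvection hij t)
    (X := single j j a) (by simp [Matrix.IsSymm, transpose_single]) using 1
  simp [transvection, transpose_add, transpose_single, add_mul, mul_add, mul_comm, pow_two,
    mul_left_comm]
  abel

lemma add_single_mem_commutatorUpper_of_ne {i j k : l} (hij : i ≠ j) (hjk : j ≠ k)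
    (a : R) : single i k a + single k i a ∈ commutatorUpper l R := by
  convert mul_mul_transpose_sub_mem_commutatorUpper (isUnit_transvection hij (1 : R))
    (X := single j k a + single k j a)
    (by simp [Matrix.IsSymm, transpose_single, add_comm]) using 1
  simp [transvection, transpose_add, transpose_single, add_mul, mul_add, hjk, hjk.symm]
  abel

lemma mem_commutatorUpper_of_isUnit {u : R} (hu : IsUnit u) (hu' : IsUnit (u ^ 2 - 1))
    {X : Matrix l l R} (hX : X.IsSymm) : X ∈ commutatorUpper l R := by
  obtain ⟨v, hv⟩ := hu'.exists_right_inv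
  have hunit : IsUnit (u • (1 : Matrix l l R)) := by
    rw [isUnit_iff_isUnit_det, det_smul, det_one, mul_one]
    exact hu.pow _
  convert mul_mul_transpose_sub_mem_commutatorUpper hunit (X := v • X) (hX.smul v) using 1
  ext i j
  simp
  linear_combination (-X i j) * hv

lemma mem_commutatorUpper_of_isUnit_two [Nontrivial l] (h2 : IsUnit (2 : R))
    {X : Matrix l l R} (hX : X.IsSymm) : X ∈ commutatorUpper l R := by
  have hdiag (i : l) (a : R) : single i i a ∈ commutatorUpper l R := by
    obtain ⟨j, hj⟩ := exists_ne i
    obtain ⟨v, hv⟩ := h2.exists_right_inv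
    convert add_mem (add_single_mem_commutatorUpper hj.symm 1 (v * a))
      (add_single_mem_commutatorUpper hj.symm (-1) (v * a)) using 1
    ext b c
    simp only [Matrix.add_apply, single_apply]
    split_ifs <;> first | ring1 | linear_combination (-a) * hv
  refine mem_of_isSymm hdiag (fun i j hij a => ?_) hX
  convert add_mem (add_single_mem_commutatorUpper hij 1 a) (hdiag i (-a)) using 1
  ext b c
  simp only [Matrix.add_apply, single_apply]
  split_ifs <;> ring

lemma mem_commutatorUpper_of_two_lt_card (hl : 2 < Fintype.card l)
    {X : Matrix l l R} (hX : X.IsSymm) : X ∈ commutatorUpper l R := by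
  have hoff (i k : l) (hik : i ≠ k) (a : R) :
      single i k a + single k i a ∈ commutatorUpper l R := by
    obtain ⟨j, hj⟩ : ∃ j, j ∉ ({i, k} : Finset l) := by
      by_contra! h
      have := Finset.card_le_card (Finset.subset_iff.2 fun j (_ : j ∈ Finset.univ) => h j)
      have := Finset.card_le_two (a := i) (b := k)
      rw [Finset.card_univ] at *
      lia
    simp only [Finset.mem_insert, Finset.mem_singleton, not_or] at hj
    exact add_single_mem_commutatorUpper_of_ne (Ne.symm hj.1) hj.2 a
  refine mem_of_isSymm (fun i a => ?_) hoff hX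
  have : Nontrivial l := Fintype.one_lt_card_iff_nontrivial.1 (by lia)
  obtain ⟨j, hj⟩ := exists_ne i
  convert add_mem (add_single_mem_commutatorUpper hj.symm 1 a) (hoff i j hj.symm (-a)) using 1
  ext b c
  simp only [Matrix.add_apply, single_apply]
  split_ifs <;> ring

/-- If all unipotent matrices `fromBlocks 1 X 0 1` with `X` symmetric lie in the commutator
subgroup, then the symplectic group over a local ring is perfect. -/
lemma commutator_eq_top_of_upper [IsLocalRing R]
    (hU : ∀ X : Matrix l l R, X.IsSymm → X ∈ commutatorUpper l R) :
    commutator (symplecticGroup l R) = ⊤ := by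
  have hL (X : Matrix l l R) (hX : X.IsSymm) :
      fromBlocks 1 0 X 1 ∈ commutatorMatrices l R := by
    refine mem_commutatorMatrices_of_conj (J_mem l R) (lower_mem hX) (hU (-X) hX.neg) ?_
    simp [J, fromBlocks_multiply]
  have hW (S T : Matrix l l R) (hS : S.IsSymm) (hT : T.IsSymm) (h : S * T = 1) :
      fromBlocks 0 S (-T) 0 ∈ commutatorMatrices l R := by
    have hS' := mem_commutatorUpper.1 (hU S hS)
    convert mul_mem (mul_mem hS' (hL (-T) hT.neg)) hS' using 1
    simp [fromBlocks_multiply, h, mul_eq_one_comm.1 h]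
  have hJ : J l R ∈ commutatorMatrices l R := by
    simpa [J] using hW (-1) (-1) isSymm_one.neg isSymm_one.neg (by simp)
  have hD (A : Matrix l l R) (hA : A ∈ symmProducts l R) :
      ∃ B, A * B = 1 ∧ fromBlocks A 0 0 Bᵀ ∈ commutatorMatrices l R := by
    induction hA using Submonoid.closure_induction with
    | mem S hS =>
      obtain ⟨T, hT⟩ := hS.2.exists_right_inv
      have hTsymm : T.IsSymm := by
        have h : T * S = 1 := mul_eq_one_comm.1 hT
        have h' : Tᵀ * S = 1 := by rw [← hS.1.eq, ← transpose_mul, hT, transpose_one]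
        calc Tᵀ = Tᵀ * (S * T) := by rw [hT, mul_one]
          _ = T := by rw [← mul_assoc, h', one_mul]
      refine ⟨T, hT, ?_⟩
      convert mul_mem (hW S T hS.1 hTsymm hT) hJ using 1
      simp [J, fromBlocks_multiply, hTsymm.eq]
    | one => exact ⟨1, by simp, by simp [one_mem]⟩
    | mul A A' _ _ ihA ihA' =>
      obtain ⟨B, hB, hBN⟩ := ihA
      obtain ⟨B', hB', hBN'⟩ := ihA'
      refine ⟨B' * B, ?_, ?_⟩
      · rw [mul_assoc, ← mul_assoc A', hB', one_mul, hB]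
      · simpa [fromBlocks_multiply] using mul_mem hBN hBN'
  refine (Subgroup.eq_top_iff' _).2 fun ⟨M, hM⟩ => ?_
  suffices M ∈ commutatorMatrices l R by
    obtain ⟨m, hm, hmM⟩ := this
    obtain rfl : m = ⟨M, hM⟩ := Subtype.ext hmM
    exact hm
  obtain ⟨A, B, C, D, rfl⟩ : ∃ A B C D, M = fromBlocks A B C D :=
    ⟨_, _, _, _, M.fromBlocks_toBlocks.symm⟩
  obtain ⟨X, hX, hdet⟩ := exists_symmetric_X_isUnit_det_add_mul_of_symplectic hM
  obtain ⟨T, hT, hTN⟩ :=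
    hD (A + X * C) (mem_symmProducts_of_isUnit ((isUnit_iff_isUnit_det _).2 hdet))
  have hXM := mul_mem (upper_mem hX) hM
  have hXM_eq : fromBlocks 1 X 0 1 * fromBlocks A B C D =
      fromBlocks (A + X * C) (B + X * D) C D := by
    simp [fromBlocks_multiply]
  rw [hXM_eq] at hXM
  set A' := A + X * C
  set B' := B + X * D
  have hT' : Tᵀ * A'ᵀ = 1 := by rw [← transpose_mul, hT, transpose_one]
  have hCT : (C * T).IsSymm := by
    calc (C * T)ᵀ = Tᵀ * (Cᵀ * A') * T := by
          rw [transpose_mul, mul_assoc, mul_assoc, hT, mul_one]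
      _ = C * T := by
          rw [← (fromBlocks_mem_iff.1 hXM).1, ← mul_assoc, hT', one_mul]
  have hP := mul_mem (lower_mem hCT.neg) hXM
  have hP_eq : fromBlocks 1 0 (-(C * T)) 1 * fromBlocks A' B' C D =
      fromBlocks A' B' 0 (D - C * T * B') := by
    simp [fromBlocks_multiply, mul_assoc, mul_eq_one_comm.1 hT, sub_eq_add_neg, add_comm]
  rw [hP_eq] at hP
  obtain ⟨-, hBD, hAD⟩ := fromBlocks_mem_iff.1 hP
  have hDT : D - C * T * B' = Tᵀ := by
    rw [transpose_zero, zero_mul, sub_zero] at hAD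
    rw [← one_mul (D - _), ← hT', mul_assoc, hAD, mul_one]
  rw [hDT, transpose_transpose] at hBD
  have hTB : (T * B').IsSymm := by rw [Matrix.IsSymm, transpose_mul, hBD]
  have hfactor : fromBlocks A B C D = fromBlocks 1 (-X) 0 1 *
      (fromBlocks 1 0 (C * T) 1 * (fromBlocks A' 0 0 Tᵀ * fromBlocks 1 (T * B') 0 1)) := by
    have hDT' : D = C * T * B' + Tᵀ := by rw [← hDT]; abel
    have hLDU : fromBlocks 1 0 (C * T) 1 * (fromBlocks A' 0 0 Tᵀ * fromBlocks 1 (T * B') 0 1) =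
        fromBlocks A' B' C D := by
      rw [hDT']
      simp only [fromBlocks_multiply, one_mul, mul_one, zero_mul, mul_zero, add_zero, zero_add,
        ← mul_assoc, hT]
      simp [mul_assoc, mul_eq_one_comm.1 hT]
    rw [hLDU]
    simp [fromBlocks_multiply, A', B']
  rw [hfactor]
  exact mul_mem (mem_commutatorUpper.1 (hU _ hX.neg)) (mul_mem (hL _ hCT)
    (mul_mem hTN (mem_commutatorUpper.1 (hU _ hTB))))

lemma isLocalRing_zmod_prime_pow {p e : ℕ} (hp : p.Prime) (he : 1 ≤ e) :
    IsLocalRing (ZMod (p ^ e)) := by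
  have : Fact (1 < p ^ e) := ⟨Nat.one_lt_pow (by lia) hp.one_lt⟩
  have : Fact p.Prime := ⟨hp⟩
  refine .of_surjective' (PadicInt.toZModPow (p := p) e) (ZMod.ringHom_surjective _)

lemma isUnit_natCast_zmod_prime_pow {p e q : ℕ} (hp : p.Prime) (hq : ¬ p ∣ q) :
    IsUnit (q : ZMod (p ^ e)) :=
  (ZMod.isUnit_iff_coprime _ _).2 (((Nat.Prime.coprime_iff_not_dvd hp).2 hq).symm.pow_right e)

end SymplecticGroup

/-- For a prime `p`, `n ≥ 1` and `e ≥ 1` with `(n,p)` not equal to `(1,2)`,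
`(1,3)` or `(2,2)`, the group `Sp(2n, ℤ/p^eℤ)` is perfect. -/
theorem sp_mod_prime_power_perfect (p n e : ℕ) (hp : p.Prime) (hn : 1 ≤ n)
    (he : 1 ≤ e)
    (h12 : ¬(n = 1 ∧ p = 2)) (h13 : ¬(n = 1 ∧ p = 3)) (h22 : ¬(n = 2 ∧ p = 2)) :
    commutator (Matrix.symplecticGroup (Fin n) (ZMod (p ^ e))) = ⊤ := by
  have : IsLocalRing (ZMod (p ^ e)) := SymplecticGroup.isLocalRing_zmod_prime_pow hp he
  refine SymplecticGroup.commutator_eq_top_of_upper fun X hX => ?_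
  by_cases hn2 : 2 < n
  · exact SymplecticGroup.mem_commutatorUpper_of_two_lt_card (by simpa using hn2) hX
  have hp2 : p ≠ 2 := by lia
  have h2 : IsUnit (2 : ZMod (p ^ e)) := by
    have : ¬ p ∣ 2 := fun h => hp2 ((Nat.prime_dvd_prime_iff_eq hp Nat.prime_two).1 h)
    exact_mod_cast SymplecticGroup.isUnit_natCast_zmod_prime_pow hp this
  obtain rfl | hn1 := eq_or_ne n 1
  · have : ¬ p ∣ 3 := fun h => h13 ⟨rfl, (Nat.prime_dvd_prime_iff_eq hp Nat.prime_three).1 h⟩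
    refine SymplecticGroup.mem_commutatorUpper_of_isUnit h2 ?_ hX
    convert SymplecticGroup.isUnit_natCast_zmod_prime_pow (e := e) hp this using 1
    norm_num
  · have : Nontrivial (Fin n) := Fin.nontrivial_iff_two_le.2 (by lia)
    exact SymplecticGroup.mem_commutatorUpper_of_isUnit_two h2 hX
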